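/- arXiv:2209.00156 — 3 statements merged into one kernel-verified Lean document; each statement's English description precedes it below -/
import Mathlib

section
/- Let X and Y be real Banach spaces, V ⊆ X a neighborhood of 0, and x₀ ∈ V. Let F : V → Y be a map of the form F(x) = L(x) + Q(x) + F(x₀) for all x ∈ V, where L : X → Y is a continuous linear bijection for which there is a constant c_L > 0 with ‖x‖ ≤ c_L·‖L x‖ for all x ∈ X, and Q : V → Y is a map for which there is a constant c_Q > 0 with ‖Q(x₁) − Q(x₂)‖ ≤ c_Q·‖x₁ − x₂‖·(‖x₁ − x₀‖ + ‖x₂ − x₀‖) for all x₁, x₂ ∈ V. If ‖F(x₀)‖ ≤ 1/(10·c_L²·c_Q) and the closed ball of radius 1/(5·c_L·c_Q) centered at x₀ is contained in V, then there exists a unique x ∈ X with ‖x − x₀‖ ≤ 1/(5·c_L·c_Q) solving F(x) = 0. -/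
/-- A self-map of a closed ball in a complete metric space which contracts distances by a factor
`K < 1` has exactly one fixed point in the ball. -/
theorem existsUnique_fixedPoint_closedBall {E : Type*} [MetricSpace E] [CompleteSpace E]
    {T : E → E} {a : E} {r K : ℝ} (hr : 0 ≤ r) (hK₀ : 0 ≤ K) (hK : K < 1)
    (hmaps : Set.MapsTo T (Metric.closedBall a r) (Metric.closedBall a r))
    (hdist : ∀ x ∈ Metric.closedBall a r, ∀ y ∈ Metric.closedBall a r,
      dist (T x) (T y) ≤ K * dist x y) :
    ∃! x, x ∈ Metric.closedBall a r ∧ T x = x := by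
  have hcontr : ContractingWith ⟨K, hK₀⟩ (hmaps.restrict T _ _) :=
    ⟨hK, LipschitzWith.of_dist_le_mul fun x y => hdist x x.2 y y.2⟩
  obtain ⟨x, hx, hfix, -⟩ := hcontr.exists_fixedPoint' Metric.isClosed_closedBall.isComplete
    hmaps (Metric.mem_closedBall_self hr) (edist_ne_top _ _)
  refine ⟨x, ⟨hx, hfix⟩, fun y ⟨hy, hyfix⟩ => ?_⟩
  have h := hdist y hy x hx
  rw [hyfix, hfix.eq] at h
  have hyx : dist y x ≤ 0 := by nlinarith
  exact dist_le_zero.mp hyx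


/-- Quantitative Banach-contraction lemma (Lemma for gluing ACyl associative
submanifolds): existence and uniqueness of a zero of `F` near `x₀`. -/
theorem banach_contraction_gluing
    {X Y : Type*} [NormedAddCommGroup X] [NormedSpace ℝ X] [CompleteSpace X]
    [NormedAddCommGroup Y] [NormedSpace ℝ Y] [CompleteSpace Y]
    (V : Set X) (hV : V ∈ nhds (0 : X)) (x₀ : X) (hx₀ : x₀ ∈ V)
    (F : X → Y) (L : X →L[ℝ] Y) (hLbij : Function.Bijective L)
    (Q : X → Y)
    (hdecomp : ∀ x ∈ V, F x = L x + Q x + F x₀)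
    (c_L : ℝ) (hcL : 0 < c_L) (hLbound : ∀ x : X, ‖x‖ ≤ c_L * ‖L x‖)
    (c_Q : ℝ) (hcQ : 0 < c_Q)
    (hQ : ∀ x₁ ∈ V, ∀ x₂ ∈ V,
      ‖Q x₁ - Q x₂‖ ≤ c_Q * ‖x₁ - x₂‖ * (‖x₁ - x₀‖ + ‖x₂ - x₀‖))
    (hFx₀ : ‖F x₀‖ ≤ 1 / (10 * c_L ^ 2 * c_Q))
    (hball : Metric.closedBall x₀ (1 / (5 * c_L * c_Q)) ⊆ V) :
    ∃! x : X, ‖x - x₀‖ ≤ 1 / (5 * c_L * c_Q) ∧ F x = 0 := by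
  set ε : ℝ := 1 / (5 * c_L * c_Q) with hε
  have hε₀ : 0 < ε := by positivity
  have hcε : c_L * c_Q * ε = 1 / 5 := by rw [hε]; field_simp
  have hFε : c_L * ‖F x₀‖ ≤ ε / 2 := by
    calc c_L * ‖F x₀‖ ≤ c_L * (1 / (10 * c_L ^ 2 * c_Q)) := by gcongr
      _ = ε / 2 := by rw [hε]; field_simp; norm_num
  choose G hG using hLbij.surjective
  have hQx₀ : L x₀ + Q x₀ = 0 := by simpa using hdecomp x₀ hx₀
  let T : X → X := fun x => G (-(Q x + F x₀))
  have hLT : ∀ x, L (T x) = -(Q x + F x₀) := fun x => hG _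
  have hzero : ∀ x ∈ V, (F x = 0 ↔ T x = x) := fun x hx => by
    rw [← hLbij.injective.eq_iff, hLT, hdecomp x hx, add_assoc, neg_eq_iff_add_eq_zero, add_comm]
  have hdist : ∀ x ∈ Metric.closedBall x₀ ε, ∀ y ∈ Metric.closedBall x₀ ε,
      dist (T x) (T y) ≤ 2 / 5 * dist x y := fun x hx y hy => by
    have hxy := hQ y (hball hy) x (hball hx)
    rw [mem_closedBall_iff_norm] at hx hy
    calc dist (T x) (T y) ≤ c_L * ‖L (T x - T y)‖ := by
          rw [dist_eq_norm]; exact hLbound _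
      _ = c_L * ‖Q y - Q x‖ := by
          rw [map_sub, hLT, hLT]; congr 2; abel
      _ ≤ c_L * (c_Q * ‖y - x‖ * (ε + ε)) := by
          refine mul_le_mul_of_nonneg_left (hxy.trans ?_) hcL.le
          gcongr
      _ = 2 / 5 * dist x y := by
          rw [dist_comm, dist_eq_norm]
          linear_combination (2 * ‖y - x‖) * hcε
  have hcenter : dist (T x₀) x₀ ≤ ε / 2 := by
    refine le_trans ?_ hFε
    rw [dist_eq_norm]
    refine (hLbound _).trans_eq ?_
    rw [map_sub, hLT, ← norm_neg (F x₀)]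
    congr 2
    rw [eq_neg_of_add_eq_zero_left hQx₀]
    abel
  have hmaps : Set.MapsTo T (Metric.closedBall x₀ ε) (Metric.closedBall x₀ ε) := fun x hx => by
    have h := hdist x hx x₀ (Metric.mem_closedBall_self hε₀.le)
    rw [Metric.mem_closedBall] at hx ⊢
    linarith [dist_triangle (T x) (T x₀) x₀]
  have hfix := existsUnique_fixedPoint_closedBall hε₀.le (by norm_num) (by norm_num) hmaps hdist
  refine (existsUnique_congr fun x => ?_).mp hfix
  rw [← mem_closedBall_iff_norm]
  exact and_congr_right fun hx => (hzero x (hball hx)).symm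
end

section
/- Let X and Y be real Banach spaces, V ⊆ X a neighborhood of 0, x₀ ∈ V, and F : V → Y a map of the form F(x) = L(x) + Q(x) + F(x₀) as in the contraction setup, with constants c_L, c_Q > 0 and ε := 1/(5·c_L·c_Q). Assume ‖F(x₀)‖ ≤ 1/(10·c_L²·c_Q) and that the closed ball of radius ε centered at x₀ is contained in V. Define φ(x) := −L⁻¹(F(x₀) + Q(x₀ + x)) − x₀ for x in the closed ball of radius ε centered at 0 ∈ X. Then for every x with ‖x‖ ≤ ε one has ‖φ(x)‖ ≤ (7/10)·ε; in particular φ maps the closed ball of radius ε centered at 0 into itself. -/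
/-- The contraction map `φ x = -L⁻¹(F x₀ + Q (x₀ + x)) - x₀` maps the closed
`ε`-ball about `0` into the closed `(7/10)·ε`-ball, in particular into itself. -/
theorem contraction_map_maps_ball_into_itself
    {X Y : Type*} [NormedAddCommGroup X] [NormedSpace ℝ X] [CompleteSpace X]
    [NormedAddCommGroup Y] [NormedSpace ℝ Y] [CompleteSpace Y]
    (V : Set X) (hV : V ∈ nhds (0 : X)) (x₀ : X) (hx₀ : x₀ ∈ V)
    (F : X → Y) (e : X ≃L[ℝ] Y)
    (Q : X → Y)
    (hdecomp : ∀ x ∈ V, F x = e x + Q x + F x₀)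
    (c_L : ℝ) (hcL : 0 < c_L) (hLbound : ∀ x : X, ‖x‖ ≤ c_L * ‖e x‖)
    (c_Q : ℝ) (hcQ : 0 < c_Q)
    (hQ : ∀ x₁ ∈ V, ∀ x₂ ∈ V,
      ‖Q x₁ - Q x₂‖ ≤ c_Q * ‖x₁ - x₂‖ * (‖x₁ - x₀‖ + ‖x₂ - x₀‖))
    (hFx₀ : ‖F x₀‖ ≤ 1 / (10 * c_L ^ 2 * c_Q))
    (hball : Metric.closedBall x₀ (1 / (5 * c_L * c_Q)) ⊆ V)
    (φ : X → X) (hφ : ∀ x : X, φ x = -(e.symm (F x₀ + Q (x₀ + x))) - x₀) :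
    ∀ x : X, ‖x‖ ≤ 1 / (5 * c_L * c_Q) →
      ‖φ x‖ ≤ (7 / 10) * (1 / (5 * c_L * c_Q)) ∧
      ‖φ x‖ ≤ 1 / (5 * c_L * c_Q) := by
  intro x hx
  have hx_mem : x₀ + x ∈ V := hball (by simpa [Metric.mem_closedBall, dist_eq_norm] using hx)
  have he₀ : e x₀ = -Q x₀ := by
    have h := hdecomp x₀ hx₀
    rw [right_eq_add] at h
    exact eq_neg_of_add_eq_zero_left h
  have heφ : e (φ x) = -(F x₀ + (Q (x₀ + x) - Q x₀)) := by
    rw [hφ, map_sub, map_neg, e.apply_symm_apply, he₀]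
    abel
  have hQx : ‖Q (x₀ + x) - Q x₀‖ ≤ c_Q * ‖x‖ * ‖x‖ := by
    simpa using hQ (x₀ + x) hx_mem x₀ hx₀
  have hbound : ‖φ x‖ ≤ (7 / 10) * (1 / (5 * c_L * c_Q)) :=
    calc
      ‖φ x‖ ≤ c_L * ‖e (φ x)‖ := hLbound _
      _ = c_L * ‖F x₀ + (Q (x₀ + x) - Q x₀)‖ := by rw [heφ, norm_neg]
      _ ≤ c_L * (‖F x₀‖ + ‖Q (x₀ + x) - Q x₀‖) := by gcongr; exact norm_add_le _ _
      _ ≤ c_L * (‖F x₀‖ + c_Q * ‖x‖ * ‖x‖) := by gcongr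
      _ ≤ c_L * (1 / (10 * c_L ^ 2 * c_Q) +
          c_Q * (1 / (5 * c_L * c_Q)) * (1 / (5 * c_L * c_Q))) := by gcongr
      _ = (7 / 10) * (1 / (5 * c_L * c_Q)) := by field_simp; norm_num
  have hε : 0 < 1 / (5 * c_L * c_Q) := by positivity
  exact ⟨hbound, by linarith⟩
end

section
/- Let X and Y be real Banach spaces, V ⊆ X a neighborhood of 0, x₀ ∈ V, and F : V → Y a map of the form F(x) = L(x) + Q(x) + F(x₀) as in the contraction setup, with constants c_L, c_Q > 0 and ε := 1/(5·c_L·c_Q). Assume the closed ball of radius ε centered at x₀ is contained in V, and define φ(x) := −L⁻¹(F(x₀) + Q(x₀ + x)) − x₀ for x in the closed ball of radius ε centered at 0 ∈ X. Then φ is a contraction with Lipschitz constant 1/2 on this ball: for all x₁, x₂ with ‖x₁‖ ≤ ε and ‖x₂‖ ≤ ε one has ‖φ(x₁) − φ(x₂)‖ ≤ (1/2)·‖x₁ − x₂‖. -/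
/-- The contraction map `φ x = -L⁻¹(F x₀ + Q (x₀ + x)) - x₀` is a contraction
with Lipschitz constant `1/2` on the closed `ε`-ball about `0`. -/
theorem contraction_map_is_contraction
    {X Y : Type*} [NormedAddCommGroup X] [NormedSpace ℝ X] [CompleteSpace X]
    [NormedAddCommGroup Y] [NormedSpace ℝ Y] [CompleteSpace Y]
    (V : Set X) (hV : V ∈ nhds (0 : X)) (x₀ : X) (hx₀ : x₀ ∈ V)
    (F : X → Y) (e : X ≃L[ℝ] Y)
    (Q : X → Y)
    (hdecomp : ∀ x ∈ V, F x = e x + Q x + F x₀)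
    (c_L : ℝ) (hcL : 0 < c_L) (hLbound : ∀ x : X, ‖x‖ ≤ c_L * ‖e x‖)
    (c_Q : ℝ) (hcQ : 0 < c_Q)
    (hQ : ∀ x₁ ∈ V, ∀ x₂ ∈ V,
      ‖Q x₁ - Q x₂‖ ≤ c_Q * ‖x₁ - x₂‖ * (‖x₁ - x₀‖ + ‖x₂ - x₀‖))
    (hball : Metric.closedBall x₀ (1 / (5 * c_L * c_Q)) ⊆ V)
    (φ : X → X) (hφ : ∀ x : X, φ x = -(e.symm (F x₀ + Q (x₀ + x))) - x₀) :
    ∀ x₁ x₂ : X, ‖x₁‖ ≤ 1 / (5 * c_L * c_Q) → ‖x₂‖ ≤ 1 / (5 * c_L * c_Q) →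
      ‖φ x₁ - φ x₂‖ ≤ (1 / 2) * ‖x₁ - x₂‖ := by
  intro x₁ x₂ h₁ h₂
  have mem : ∀ x : X, ‖x‖ ≤ 1 / (5 * c_L * c_Q) → x₀ + x ∈ V := fun x hx =>
    hball (by simpa [Metric.mem_closedBall, dist_eq_norm] using hx)
  have hQ' := hQ _ (mem x₁ h₁) _ (mem x₂ h₂)
  simp only [add_sub_add_left_eq_sub, add_sub_cancel_left] at hQ'
  have hdiff : φ x₁ - φ x₂ = -e.symm (Q (x₀ + x₁) - Q (x₀ + x₂)) := by
    simp only [hφ, map_add, map_sub]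
    abel
  have hL := hLbound (e.symm (Q (x₀ + x₁) - Q (x₀ + x₂)))
  rw [e.apply_symm_apply] at hL
  rw [hdiff, norm_neg]
  calc ‖e.symm (Q (x₀ + x₁) - Q (x₀ + x₂))‖
      ≤ c_L * ‖Q (x₀ + x₁) - Q (x₀ + x₂)‖ := hL
    _ ≤ c_L * (c_Q * ‖x₁ - x₂‖ * (‖x₁‖ + ‖x₂‖)) := by gcongr
    _ ≤ c_L * (c_Q * ‖x₁ - x₂‖ * (1 / (5 * c_L * c_Q) + 1 / (5 * c_L * c_Q))) := by gcongr
    _ = (2 / 5) * ‖x₁ - x₂‖ := by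
      field_simp
      ring
    _ ≤ (1 / 2) * ‖x₁ - x₂‖ :=
      mul_le_mul_of_nonneg_right (by norm_num) (norm_nonneg _)
end
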